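/- arXiv:2305.04734 — 2 statements merged into one kernel-verified Lean document; each statement's English description precedes it below -/
import Mathlib

section
/- (Existence and uniqueness of the PBDW saddle-point solution.) Let U be a real Hilbert space and let Z_N and U_M be finite-dimensional subspaces of U satisfying Z_N ∩ U_M^⊥ = {0}. Then for every u ∈ U there exists a unique pair (z, η) ∈ Z_N × U_M such that (η, q) + (z, q) = (u, q) for all q ∈ U_M and (η, p) = 0 for all p ∈ Z_N. -/
open scoped RealInnerProductSpace

/-- A PBDW saddle-point solution for data `u`: a pair `(z, η) ∈ Z_N × U_M` such that
`(η, q) + (z, q) = (u, q)` for all `q ∈ U_M` and `(η, p) = 0` for all `p ∈ Z_N`. -/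
def IsPBDWSolution {U : Type*} [NormedAddCommGroup U] [InnerProductSpace ℝ U]
    (Z UM : Submodule ℝ U) (u z η : U) : Prop :=
  z ∈ Z ∧ η ∈ UM ∧
    (∀ q ∈ UM, ⟪η, q⟫ + ⟪z, q⟫ = ⟪u, q⟫) ∧
    (∀ p ∈ Z, ⟪η, p⟫ = 0)

theorem IsPBDWSolution.eq_of_inf_orthogonal_eq_bot {U : Type*} [NormedAddCommGroup U]
    [InnerProductSpace ℝ U] {Z UM : Submodule ℝ U} (h : Z ⊓ UMᗮ = ⊥) {u z η z' η' : U}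
    (hs : IsPBDWSolution Z UM u z η) (hs' : IsPBDWSolution Z UM u z' η') :
    z = z' ∧ η = η' := by
  obtain ⟨hz, hη, hsum, horth⟩ := hs
  obtain ⟨hz', hη', hsum', horth'⟩ := hs'
  have hd : z - z' ∈ Z := Z.sub_mem hz hz'
  have key : ∀ q ∈ UM, ⟪η - η', q⟫ + ⟪z - z', q⟫ = 0 := fun q hq => by
    rw [inner_sub_left, inner_sub_left]
    linarith [hsum q hq, hsum' q hq]
  have hη_eq : η - η' = 0 := by
    have h1 := key _ (UM.sub_mem hη hη')
    have h2 : ⟪z - z', η - η'⟫ = 0 := by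
      rw [real_inner_comm, inner_sub_left, horth _ hd, horth' _ hd, sub_zero]
    rwa [h2, add_zero, inner_self_eq_zero] at h1
  have hz_eq : z - z' ∈ Z ⊓ UMᗮ :=
    ⟨hd, (Submodule.mem_orthogonal' _ _).2 fun q hq => by simpa [hη_eq] using key q hq⟩
  rw [h, Submodule.mem_bot] at hz_eq
  exact ⟨sub_eq_zero.1 hz_eq, sub_eq_zero.1 hη_eq⟩

theorem exists_isPBDWSolution {U : Type*} [NormedAddCommGroup U] [InnerProductSpace ℝ U]
    (Z UM : Submodule ℝ U) [FiniteDimensional ℝ Z] [UM.HasOrthogonalProjection] (u : U) :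
    ∃ z η, IsPBDWSolution Z UM u z η := by
  have proj_inner : ∀ x : U, ∀ q ∈ UM, ⟪UM.starProjection x, q⟫ = ⟪x, q⟫ := fun x q hq => by
    rw [Submodule.inner_starProjection_left_eq_right, Submodule.starProjection_eq_self_iff.mpr hq]
  let W : Submodule ℝ U := Z.map (UM.starProjection : U →ₗ[ℝ] U)
  obtain ⟨z, hz, hzw⟩ := Submodule.mem_map.mp
    (Submodule.starProjection_apply_mem W (UM.starProjection u))
  have hzw : UM.starProjection z = W.starProjection (UM.starProjection u) := hzw
  have hη : UM.starProjection u - UM.starProjection z ∈ UM :=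
    UM.sub_mem (UM.starProjection_apply_mem u) (UM.starProjection_apply_mem z)
  refine ⟨z, UM.starProjection u - UM.starProjection z, hz, hη, fun q hq => ?_, fun p hp => ?_⟩
  · rw [inner_sub_left, proj_inner u q hq, proj_inner z q hq, sub_add_cancel]
  · rw [real_inner_comm, ← proj_inner p _ hη, hzw]
    exact Submodule.inner_right_of_mem_orthogonal (K := W) (Submodule.mem_map_of_mem hp)
      (W.sub_starProjection_mem_orthogonal _)

/-- If `Z` and `UM` are finite-dimensional subspaces of a real Hilbert
space `U` with `Z ⊓ UMᗮ = ⊥`, then for every `u ∈ U` there exists a unique PBDW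
saddle-point solution `(z, η) ∈ Z × UM` for data `u`. -/
theorem stmt_1 {U : Type*} [NormedAddCommGroup U] [InnerProductSpace ℝ U] [CompleteSpace U]
    (Z UM : Submodule ℝ U) [FiniteDimensional ℝ Z] [FiniteDimensional ℝ UM]
    (h : Z ⊓ UMᗮ = ⊥) (u : U) :
    ∃! zη : U × U, IsPBDWSolution Z UM u zη.1 zη.2 := by
  obtain ⟨z, η, hs⟩ := exists_isPBDWSolution Z UM u
  exact ⟨(z, η), hs, fun _ hs' =>
    Prod.ext_iff.2 (IsPBDWSolution.eq_of_inf_orthogonal_eq_bot h hs' hs)⟩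
end

section
/- (Minimization property of the PBDW saddle point.) Let U be a real Hilbert space, Z_N and U_M finite-dimensional subspaces of U, and u ∈ U. Suppose (z*, η*) ∈ Z_N × U_M is a PBDW saddle-point solution for data u. Then for every pair (z, η) ∈ Z_N × U_M satisfying the observation constraint (z + η, q) = (u, q) for all q ∈ U_M, one has ‖η*‖ ≤ ‖η‖; that is, the saddle-point solution minimizes ‖η‖ over all feasible pairs. -/
open scoped RealInnerProductSpace

/-- (Minimization property of the PBDW saddle point.) If `(zs, ηs)` is a
PBDW saddle-point solution for data `u`, then among all pairs `(z, η) ∈ Z × UM`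
satisfying the observation constraint `(z + η, q) = (u, q)` for all `q ∈ UM`,
the saddle-point solution minimizes `‖η‖`. -/
theorem stmt_2 {U : Type*} [NormedAddCommGroup U] [InnerProductSpace ℝ U] [CompleteSpace U]
    (Z UM : Submodule ℝ U) [FiniteDimensional ℝ Z] [FiniteDimensional ℝ UM]
    (u zs ηs : U) (hsol : IsPBDWSolution Z UM u zs ηs) :
    ∀ z η : U, z ∈ Z → η ∈ UM → (∀ q ∈ UM, ⟪z + η, q⟫ = ⟪u, q⟫) → ‖ηs‖ ≤ ‖η‖ := by
  obtain ⟨hzs, hηs, hobs, horth⟩ := hsol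
  intro z η hz _ hfeas
  have hs := hobs ηs hηs
  have hf := hfeas ηs hηs
  rw [real_inner_comm ηs zs, horth zs hzs, real_inner_self_eq_norm_sq] at hs
  rw [inner_add_left, real_inner_comm ηs z, horth z hz] at hf
  have hcs := real_inner_le_norm η ηs
  rcases (norm_nonneg ηs).eq_or_lt with h0 | hpos
  · exact h0 ▸ norm_nonneg η
  · exact le_of_mul_le_mul_right (by linarith [sq ‖ηs‖]) hpos
end
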